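/- For every integer n ≥ 2 and every τ ∈ (-1,1), one has V(τ) > 0 and the function ψ is differentiable at τ with derivative ψ'(τ) = A₀(τ) · ( n²·V(τ) − (n−1)·(A(τ) + τ·A₀(τ)) ) / ( n · V(τ)^{2 − 1/n} ). -/

import Mathlib

open MeasureTheory Real

/-- `omegaBall k` is the Lebesgue measure of the unit ball of `ℝ^k`. -/
noncomputable def omegaBall (k : ℕ) : ℝ :=
  (volume (Metric.ball (0 : EuclideanSpace ℝ (Fin k)) 1)).toReal

/-- `capV n τ = ∫_{-τ}^1 ω_{n-1} (1-ρ²)^{(n-1)/2} dρ`, the volume of the spherical cap. -/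
noncomputable def capV (n : ℕ) (τ : ℝ) : ℝ :=
  ∫ ρ in (-τ)..1, omegaBall (n - 1) * (1 - ρ ^ 2) ^ (((n : ℝ) - 1) / 2)

/-- `capA n τ = ∫_{-τ}^1 (n-1) ω_{n-1} (1-ρ²)^{(n-3)/2} dρ`, the spherical area of the cap. -/
noncomputable def capA (n : ℕ) (τ : ℝ) : ℝ :=
  ∫ ρ in (-τ)..1, ((n : ℝ) - 1) * omegaBall (n - 1) * (1 - ρ ^ 2) ^ (((n : ℝ) - 3) / 2)

/-- `capA0 n τ = ω_{n-1} (1-τ²)^{(n-1)/2}`, the area of the flat face of the cap. -/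
noncomputable def capA0 (n : ℕ) (τ : ℝ) : ℝ :=
  omegaBall (n - 1) * (1 - τ ^ 2) ^ (((n : ℝ) - 1) / 2)

/-- `psiFun n τ = (A(τ) + τ A₀(τ)) / V(τ)^{(n-1)/n}`, the normalized capillarity energy. -/
noncomputable def psiFun (n : ℕ) (τ : ℝ) : ℝ :=
  (capA n τ + τ * capA0 n τ) / (capV n τ) ^ (((n : ℝ) - 1) / (n : ℝ))

lemma cap_integrable (s τ : ℝ) (hs : -1 < s) (hτ : τ ∈ Set.Ioo (-1 : ℝ) 1) :
    IntervalIntegrable (fun ρ : ℝ => (1 - ρ ^ 2) ^ s) volume (-τ) 1 := by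
  obtain ⟨h1, h2⟩ := hτ
  have hle : -τ ≤ 1 := by linarith
  have a : IntervalIntegrable (fun x : ℝ => x ^ s) volume (1 - -τ) (1 - 1) :=
    intervalIntegral.intervalIntegrable_rpow' hs
  have b := a.comp_sub_left 1
  simp only [sub_sub_cancel] at b
  have c : ContinuousOn (fun ρ : ℝ => (1 + ρ) ^ s) (Set.uIcc (-τ) 1) := by
    rw [Set.uIcc_of_le hle]
    apply ContinuousOn.rpow_const (by fun_prop)
    intro x hx
    left
    have := hx.1
    linarith
  refine (b.mul_continuousOn c).congr ?_
  intro x hx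
  rw [Set.uIoc_of_le hle] at hx
  have := hx.1
  have := hx.2
  simp only
  rw [← Real.mul_rpow (by linarith) (by linarith)]
  congr 1
  ring

lemma cap_pos {x : ℝ} (hx : x ∈ Set.Ioo (-1 : ℝ) 1) : 0 < 1 - x ^ 2 := by
  obtain ⟨h1, h2⟩ := hx
  nlinarith

lemma cap_deriv (s τ c : ℝ) (hs : -1 < s) (hτ : τ ∈ Set.Ioo (-1 : ℝ) 1) :
    HasDerivAt (fun t : ℝ => ∫ ρ in (-t)..1, c * (1 - ρ ^ 2) ^ s) (c * (1 - τ ^ 2) ^ s) τ := by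
  have hi := (cap_integrable s τ hs hτ).const_mul c
  have hp := cap_pos hτ
  have hc : ContinuousAt (fun ρ : ℝ => c * (1 - ρ ^ 2) ^ s) (-τ) := by
    apply ContinuousAt.const_mul
    apply ContinuousAt.rpow_const (by fun_prop)
    left
    rw [neg_sq]
    exact hp.ne'
  have hm : StronglyMeasurableAtFilter (fun ρ : ℝ => c * (1 - ρ ^ 2) ^ s) (nhds (-τ)) :=
    (Measurable.stronglyMeasurable (by fun_prop)).stronglyMeasurableAtFilter
  have h := intervalIntegral.integral_hasDerivAt_left hi hm hc
  have h2 := HasDerivAt.comp τ h (hasDerivAt_neg τ)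
  refine HasDerivAt.congr_deriv h2 ?_
  rw [neg_sq]
  ring

lemma omegaBall_pos (k : ℕ) : 0 < omegaBall k := by
  unfold omegaBall
  exact ENNReal.toReal_pos (Metric.measure_ball_pos _ _ one_pos).ne' measure_ball_lt_top.ne

/-- For every `n ≥ 2` and `τ ∈ (-1,1)`, one has `V(τ) > 0` and `ψ` is differentiable at `τ`
with derivative `ψ'(τ) = A₀(τ)·(n²V(τ) − (n−1)(A(τ)+τA₀(τ))) / (n·V(τ)^{2−1/n})`. -/
theorem psi_hasDerivAt (n : ℕ) (hn : 2 ≤ n) (τ : ℝ) (hτ : τ ∈ Set.Ioo (-1 : ℝ) 1) :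
    0 < capV n τ ∧
    HasDerivAt (psiFun n)
      (capA0 n τ * ((n : ℝ) ^ 2 * capV n τ - ((n : ℝ) - 1) * (capA n τ + τ * capA0 n τ)) /
        ((n : ℝ) * capV n τ ^ (2 - 1 / (n : ℝ)))) τ := by
  have hn' : (2 : ℝ) ≤ n := by exact_mod_cast hn
  have hp := cap_pos hτ
  have hV : 0 < capV n τ := by
    unfold capV
    apply intervalIntegral.intervalIntegral_pos_of_pos_on
    · exact (cap_integrable _ τ (by linarith) hτ).const_mul _
    · intro x hx
      have := cap_pos (x := x) ⟨by linarith [hx.1, hτ.2], hx.2⟩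
      exact mul_pos (omegaBall_pos _) (Real.rpow_pos_of_pos this _)
    · linarith [hτ.1]
  refine ⟨hV, ?_⟩
  have dV : HasDerivAt (capV n) (capA0 n τ) τ := cap_deriv _ τ _ (by linarith) hτ
  have dA : HasDerivAt (capA n) _ τ :=
    cap_deriv (((n : ℝ) - 3) / 2) τ (((n : ℝ) - 1) * omegaBall (n - 1)) (by linarith) hτ
  have dq : HasDerivAt (fun t : ℝ => 1 - t ^ 2) (-(2 * τ)) τ := by
    simpa using (hasDerivAt_pow 2 τ).const_sub 1
  have d0 : HasDerivAt (capA0 n) _ τ :=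
    (dq.rpow_const (p := ((n : ℝ) - 1) / 2) (Or.inl hp.ne')).const_mul (omegaBall (n - 1))
  have e1 : (1 - τ ^ 2) ^ (((n : ℝ) - 1) / 2) =
      (1 - τ ^ 2) ^ (((n : ℝ) - 3) / 2) * (1 - τ ^ 2) := by
    rw [← Real.rpow_add_one hp.ne']
    congr 1
    ring
  have e2 : ((n : ℝ) - 1) / 2 - 1 = ((n : ℝ) - 3) / 2 := by ring
  have dN : HasDerivAt (fun t => capA n t + t * capA0 n t) (n * capA0 n τ) τ := by
    refine HasDerivAt.congr_deriv (dA.add ((hasDerivAt_id τ).mul d0)) ?_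
    rw [e2]
    simp only [capA0, e1, id]
    ring
  have dP := dV.rpow_const (p := ((n : ℝ) - 1) / n) (Or.inl hV.ne')
  have hP : 0 < capV n τ ^ (((n : ℝ) - 1) / n) := Real.rpow_pos_of_pos hV _
  have hd : HasDerivAt (psiFun n) _ τ := dN.div dP hP.ne'
  refine hd.congr_deriv (Eq.symm ?_)
  have hn0 : (n : ℝ) ≠ 0 := by linarith
  have e3 : capV n τ ^ (2 - 1 / (n : ℝ)) = capV n τ ^ (((n : ℝ) - 1) / n) * capV n τ := by
    rw [← Real.rpow_add_one hV.ne']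
    congr 1
    field_simp
    ring
  rw [e3, Real.rpow_sub_one hV.ne']
  have hV' := hV.ne'
  have hP' := hP.ne'
  generalize capV n τ ^ (((n : ℝ) - 1) / n) = P at *
  field_simp
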